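/- Suppose labeled posets (P,ω) and (Q,τ) satisfy (P,ω) ~ (Q,τ). Then the labeled posets (P̂,ω̂) and (Q̂,τ̂) obtained by removing all jump-0 elements satisfy (P̂,ω̂) ~ (Q̂,τ̂). -/

import Mathlib

/-- A labeling of a finite poset: a bijection onto `{1, …, n}`. -/
def IsLabeling {α : Type*} (ω : α → ℕ) : Prop :=
  Set.BijOn ω Set.univ (Set.Icc 1 (Nat.card α))

/-- `f` is a `(P,ω)`-partition. -/
def IsPtn {α : Type*} [PartialOrder α] (ω : α → ℕ) (f : α → ℕ) : Prop :=
  (∀ a, 1 ≤ f a) ∧ (∀ a b : α, a ≤ b → f a ≤ f b) ∧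
    (∀ a b : α, a ≤ b → ω b < ω a → f a < f b)

/-- The number of `(P,ω)`-partitions of weight `w`. -/
noncomputable def ptnCount {α : Type*} [PartialOrder α] (ω : α → ℕ) (w : ℕ →₀ ℕ) : ℕ :=
  Set.ncard {f : α → ℕ | IsPtn ω f ∧ ∀ m : ℕ, 1 ≤ m → (f ⁻¹' {m}).ncard = w m}

/-- `(P,ω) ~ (Q,τ)`: equality of the `(P,ω)`-partition generating functions. -/
def KEq {α β : Type*} [PartialOrder α] [PartialOrder β] (ω : α → ℕ) (τ : β → ℕ) : Prop :=
  ∀ w : ℕ →₀ ℕ, ptnCount ω w = ptnCount τ w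

/-- `l` is a saturated chain from `b` down to a minimal element. -/
def IsSatDownChain {α : Type*} [PartialOrder α] (b : α) (l : List α) : Prop :=
  l.head? = some b ∧ List.Chain' (fun x y => y ⋖ x) l ∧
    ∃ m, l.getLast? = some m ∧ IsMin m

/-- The number of strict edges of a saturated chain `l = [c₀, …, c_k]`. -/
def strictEdgeCount {α : Type*} (ω : α → ℕ) (l : List α) : ℕ :=
  ((l.zip l.tail).filter fun p => decide (ω p.1 < ω p.2)).length

/-- The jump of `b` in `(P,ω)`: the maximum number of strict edges on a saturated chain
from `b` down to a minimal element. -/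
noncomputable def jump {α : Type*} [PartialOrder α] (ω : α → ℕ) (b : α) : ℕ :=
  sSup {k : ℕ | ∃ l : List α, IsSatDownChain b l ∧ strictEdgeCount ω l = k}

/-- `a` lies above the upper end of a strict relation of `(P,ω)`. -/
def AboveStrict {α : Type*} [PartialOrder α] (ω : α → ℕ) (a : α) : Prop :=
  ∃ x y : α, x ≤ y ∧ y ≤ a ∧ ω y < ω x

theorem IsSatDownChain.cons {α : Type*} [PartialOrder α] {c b : α} {l : List α}
    (hl : IsSatDownChain c l) (h : c ⋖ b) : IsSatDownChain b (b :: l) := by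
  obtain ⟨h1, h2, m, h3, h4⟩ := hl
  cases l with
  | nil => simp at h1
  | cons d l =>
    simp only [List.head?_cons, Option.some.injEq] at h1
    subst h1
    refine ⟨rfl, ?_, m, ?_, h4⟩
    · exact List.isChain_cons_cons.2 ⟨h, h2⟩
    · rw [List.getLast?_cons_cons]; exact h3

theorem strictEdgeCount_cons_cons {α : Type*} (ω : α → ℕ) (b c : α) (l : List α) :
    strictEdgeCount ω (b :: c :: l) =
      (if ω b < ω c then 1 else 0) + strictEdgeCount ω (c :: l) := by
  unfold strictEdgeCount
  by_cases h : ω b < ω c <;> simp [h, add_comm]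

theorem IsSatDownChain.eq_cons {α : Type*} [PartialOrder α] {c : α} {l : List α}
    (hl : IsSatDownChain c l) : ∃ l', l = c :: l' := by
  cases l with
  | nil => simp [IsSatDownChain] at hl
  | cons d l =>
    have := hl.1
    simp only [List.head?_cons, Option.some.injEq] at this
    exact ⟨l, by rw [this]⟩

theorem exists_isSatDownChain {α : Type*} [PartialOrder α] [Finite α] (b : α) :
    ∃ l, IsSatDownChain b l := by
  induction b using WellFoundedLT.induction with
  | ind b ih =>
    by_cases hb : IsMin b
    · exact ⟨[b], rfl, List.isChain_singleton b, b, rfl, hb⟩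
    · obtain ⟨c, hc⟩ := not_isMin_iff.1 hb
      obtain ⟨d, -, hd⟩ := exists_le_covBy_of_lt hc
      obtain ⟨l, hl⟩ := ih d hd.lt
      exact ⟨_, hl.cons hd⟩

theorem AboveStrict.exists_chain {α : Type*} [PartialOrder α] [Finite α] {ω : α → ℕ} {a : α}
    (h : AboveStrict ω a) : ∃ l, IsSatDownChain a l ∧ strictEdgeCount ω l ≠ 0 := by
  induction a using WellFoundedLT.induction with
  | ind a ih =>
    have step : ∀ c, c ⋖ a → AboveStrict ω c →
        ∃ l, IsSatDownChain a l ∧ strictEdgeCount ω l ≠ 0 := by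
      intro c hca hc
      obtain ⟨l, hl, hl0⟩ := ih c hca.lt hc
      obtain ⟨l', rfl⟩ := hl.eq_cons
      refine ⟨_, hl.cons hca, ?_⟩
      rw [strictEdgeCount_cons_cons]
      omega
    obtain ⟨x, y, hxy, hya, hω⟩ := h
    rcases hya.eq_or_lt with rfl | hya
    · have hlt : x < y := lt_of_le_of_ne hxy (by rintro rfl; exact lt_irrefl _ hω)
      obtain ⟨c, hxc, hcy⟩ := exists_le_covBy_of_lt hlt
      by_cases hc : ω y < ω c
      · obtain ⟨l, hl⟩ := exists_isSatDownChain c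
        obtain ⟨l', rfl⟩ := hl.eq_cons
        refine ⟨_, hl.cons hcy, ?_⟩
        rw [strictEdgeCount_cons_cons, if_pos hc]
        omega
      · exact step c hcy ⟨x, c, hxc, le_rfl, by omega⟩
    · obtain ⟨c, hyc, hca⟩ := exists_le_covBy_of_lt hya
      exact step c hca ⟨x, y, hxy, hyc, hω⟩

theorem IsSatDownChain.aboveStrict {α : Type*} [PartialOrder α] {ω : α → ℕ} {a : α} {l : List α}
    (hl : IsSatDownChain a l) (h : strictEdgeCount ω l ≠ 0) : AboveStrict ω a := by
  obtain ⟨l, rfl⟩ := hl.eq_cons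
  have hc : List.IsChain (fun x y => y ⋖ x) (a :: l) := hl.2.1
  clear hl
  induction l generalizing a with
  | nil => simp [strictEdgeCount] at h
  | cons b l ih =>
    obtain ⟨hba, hc⟩ := List.isChain_cons_cons.1 hc
    rw [strictEdgeCount_cons_cons] at h
    by_cases hab : ω a < ω b
    · exact ⟨b, a, hba.le, le_rfl, hab⟩
    · obtain ⟨x, y, hxy, hyb, hω⟩ := ih (by simpa [hab] using h) hc
      exact ⟨x, y, hxy, hyb.trans hba.le, hω⟩

theorem IsSatDownChain.length_le {α : Type*} [PartialOrder α] [Fintype α] {a : α} {l : List α}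
    (hl : IsSatDownChain a l) : l.length ≤ Fintype.card α := by
  have hc : List.IsChain (fun x y : α => y < x) l := List.IsChain.imp (fun _ _ h => h.lt) hl.2.1
  have hp : List.Pairwise (fun x y : α => y < x) l := by
    have : IsTrans α (fun x y : α => y < x) := ⟨fun _ _ _ h1 h2 => h2.trans h1⟩
    exact List.isChain_iff_pairwise.1 hc
  exact List.Nodup.length_le_card (hp.imp fun h => h.ne')

theorem jump_ne_zero_iff {α : Type*} [PartialOrder α] [Fintype α] (ω : α → ℕ) (a : α) :
    jump ω a ≠ 0 ↔ AboveStrict ω a := by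
  have hb : BddAbove {k : ℕ | ∃ l : List α, IsSatDownChain a l ∧ strictEdgeCount ω l = k} := by
    refine ⟨Fintype.card α, ?_⟩
    rintro k ⟨l, hl, rfl⟩
    refine le_trans ?_ hl.length_le
    refine (List.length_filter_le _ _).trans ?_
    simp
  constructor
  · intro h
    obtain ⟨l₀, hl₀⟩ := exists_isSatDownChain a
    have hne : {k : ℕ | ∃ l : List α, IsSatDownChain a l ∧ strictEdgeCount ω l = k}.Nonempty :=
      ⟨_, l₀, hl₀, rfl⟩
    obtain ⟨l, hl, hk⟩ := Nat.sSup_mem hne hb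
    exact hl.aboveStrict (hk.trans_ne h)
  · intro h
    obtain ⟨l, hl, hk⟩ := h.exists_chain
    have := le_csSup hb ⟨l, hl, rfl⟩
    unfold jump
    omega

theorem AboveStrict.mono {α : Type*} [PartialOrder α] {ω : α → ℕ} {a b : α}
    (h : AboveStrict ω a) (hab : a ≤ b) : AboveStrict ω b := by
  obtain ⟨x, y, hxy, hya, hω⟩ := h
  exact ⟨x, y, hxy, hya.trans hab, hω⟩

theorem IsPtn.one_lt {α : Type*} [PartialOrder α] {ω : α → ℕ} {f : α → ℕ} (hf : IsPtn ω f) {a : α}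
    (h : AboveStrict ω a) : 1 < f a := by
  obtain ⟨x, y, hxy, hya, hω⟩ := h
  exact (hf.1 x).trans_lt ((hf.2.2 x y hxy hω).trans_le (hf.2.1 y a hya))

theorem finite_setOf_isPtn {α : Type*} [PartialOrder α] [Finite α] (ω : α → ℕ) (w : ℕ →₀ ℕ) :
    {f : α → ℕ | IsPtn ω f ∧ ∀ m : ℕ, 1 ≤ m → (f ⁻¹' {m}).ncard = w m}.Finite := by
  refine (Set.Finite.pi' (t := fun _ : α => (w.support : Set ℕ))
    (fun _ => w.support.finite_toSet)).subset ?_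
  rintro f ⟨hf, hw⟩ a
  rw [Finset.mem_coe, Finsupp.mem_support_iff, ← hw (f a) (hf.1 a)]
  exact Set.ncard_ne_zero_of_mem (a := a) rfl (Set.toFinite _)

theorem ptnCount_ne_zero_iff {α : Type*} [PartialOrder α] [Finite α] (ω : α → ℕ) (w : ℕ →₀ ℕ) :
    ptnCount ω w ≠ 0 ↔ ∃ f, IsPtn ω f ∧ ∀ m : ℕ, 1 ≤ m → (f ⁻¹' {m}).ncard = w m :=
  Nat.pos_iff_ne_zero.symm.trans (Set.ncard_pos (finite_setOf_isPtn ω w))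

theorem exists_ptnCount_ne_zero {α : Type*} [PartialOrder α] [Finite α] (ω : α → ℕ) :
    ∃ w, ptnCount ω w ≠ 0 := by
  classical
  have hmono : ∀ a b : α, a < b → (Set.Iic a).ncard < (Set.Iic b).ncard := fun a b hab =>
    Set.ncard_lt_ncard (Set.Iic_ssubset_Iic.2 hab)
  let f : α → ℕ := fun a => (Set.Iic a).ncard
  have hfin : (Function.support fun m => (f ⁻¹' {m}).ncard).Finite := by
    refine (Set.finite_range f).subset fun m hm => ?_
    obtain ⟨a, ha⟩ := Set.nonempty_of_ncard_ne_zero hm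
    exact ⟨a, ha⟩
  refine ⟨Finsupp.ofSupportFinite _ hfin, (ptnCount_ne_zero_iff _ _).2 ⟨f, ⟨?_, ?_, ?_⟩, ?_⟩⟩
  · exact fun a => Nat.one_le_iff_ne_zero.2 (Set.ncard_ne_zero_of_mem (a := a) le_rfl (Set.toFinite _))
  · exact fun a b hab => Set.ncard_le_ncard (Set.Iic_subset_Iic.2 hab)
  · exact fun a b hab hω =>
      hmono a b (lt_of_le_of_ne hab (by rintro rfl; exact lt_irrefl _ hω))
  · exact fun m _ => rfl

/-- The weight with first part `k` followed by the parts of `w`. -/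
noncomputable def consWeight (k : ℕ) (w : ℕ →₀ ℕ) : ℕ →₀ ℕ :=
  (w.mapDomain Nat.succ).update 1 k

theorem consWeight_one (k : ℕ) (w : ℕ →₀ ℕ) : consWeight k w 1 = k := by
  simp [consWeight]

theorem consWeight_succ (k : ℕ) (w : ℕ →₀ ℕ) {m : ℕ} (hm : 1 ≤ m) :
    consWeight k w (m + 1) = w m := by
  classical
  have h : m + 1 ≠ 1 := by omega
  rw [consWeight, Finsupp.update_apply, if_neg h]
  exact Finsupp.mapDomain_apply Nat.succ_injective w m

/-- Extend a function on a subtype by `1`, shifting its values up by one. -/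
noncomputable def extendOne {α : Type*} (p : α → Prop) (g : {a // p a} → ℕ) (a : α) : ℕ :=
  open Classical in if h : p a then g ⟨a, h⟩ + 1 else 1

theorem extendOne_of_pos {α : Type*} {p : α → Prop} (g : {a // p a} → ℕ) {a : α} (h : p a) :
    extendOne p g a = g ⟨a, h⟩ + 1 := dif_pos h

theorem extendOne_of_neg {α : Type*} {p : α → Prop} (g : {a // p a} → ℕ) {a : α} (h : ¬ p a) :
    extendOne p g a = 1 := dif_neg h

theorem extendOne_injective {α : Type*} (p : α → Prop) :
    Function.Injective (extendOne p) := by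
  intro g₁ g₂ h
  funext a
  have := congrFun h a.1
  rw [extendOne_of_pos _ a.2, extendOne_of_pos _ a.2] at this
  exact Nat.succ_injective this

theorem extendOne_preimage_one {α : Type*} {p : α → Prop} {g : {a // p a} → ℕ}
    (hg : ∀ a, 1 ≤ g a) : extendOne p g ⁻¹' {1} = {a | ¬ p a} := by
  ext a
  by_cases h : p a
  · have := hg ⟨a, h⟩
    simp only [Set.mem_preimage, extendOne_of_pos g h, Set.mem_singleton_iff, Set.mem_ofPred_eq, h]
    simp only [not_true_eq_false, iff_false]
    omega
  · simp [extendOne_of_neg g h, h]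

theorem ncard_extendOne_preimage_succ {α : Type*} {p : α → Prop} (g : {a // p a} → ℕ)
    {m : ℕ} (hm : 1 ≤ m) : (extendOne p g ⁻¹' {m + 1}).ncard = (g ⁻¹' {m}).ncard := by
  rw [← Set.ncard_image_of_injective (g ⁻¹' {m}) Subtype.val_injective]
  congr 1
  ext a
  by_cases h : p a
  · simp [extendOne_of_pos g h, h]
  · simp only [Set.mem_preimage, extendOne_of_neg g h, Set.mem_singleton_iff, Set.mem_image,
      Subtype.exists, exists_and_right, exists_eq_right, h, IsEmpty.exists_iff, iff_false]
    omega

section Removal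

variable {α : Type*} [PartialOrder α] {ω : α → ℕ} {p : α → Prop} {ω' : {a // p a} → ℕ}

theorem isPtn_extendOne_iff (hp : ∀ a, p a ↔ AboveStrict ω a)
    (hω' : ∀ a b, ω' a < ω' b ↔ ω a.1 < ω b.1) (g : {a // p a} → ℕ) (hg : ∀ a, 1 ≤ g a) :
    IsPtn ω (extendOne p g) ↔ IsPtn ω' g := by
  have hup : ∀ a b, a ≤ b → p a → p b := fun a b hab ha =>
    (hp b).2 (((hp a).1 ha).mono hab)
  have hone : ∀ a, 1 ≤ extendOne p g a := by
    intro a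
    by_cases h : p a
    · rw [extendOne_of_pos g h]; omega
    · rw [extendOne_of_neg g h]
  constructor
  · rintro ⟨-, h1, h2⟩
    refine ⟨hg, fun a b hab => ?_, fun a b hab hlt => ?_⟩
    · have := h1 a.1 b.1 hab
      rw [extendOne_of_pos g a.2, extendOne_of_pos g b.2] at this
      exact Nat.le_of_succ_le_succ this
    · have := h2 a.1 b.1 hab ((hω' b a).1 hlt)
      rw [extendOne_of_pos g a.2, extendOne_of_pos g b.2] at this
      exact Nat.lt_of_succ_lt_succ this
  · rintro ⟨-, h1, h2⟩
    refine ⟨hone, fun a b hab => ?_, fun a b hab hlt => ?_⟩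
    · by_cases ha : p a
      · have hb := hup a b hab ha
        rw [extendOne_of_pos g ha, extendOne_of_pos g hb]
        exact Nat.succ_le_succ (h1 ⟨a, ha⟩ ⟨b, hb⟩ hab)
      · rw [extendOne_of_neg g ha]
        exact hone b
    · have hb : p b := (hp b).2 ⟨a, b, hab, le_rfl, hlt⟩
      by_cases ha : p a
      · rw [extendOne_of_pos g ha, extendOne_of_pos g hb]
        exact Nat.succ_lt_succ (h2 ⟨a, ha⟩ ⟨b, hb⟩ hab ((hω' _ _).2 hlt))
      · rw [extendOne_of_neg g ha, extendOne_of_pos g hb]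
        have := hg ⟨b, hb⟩
        omega

theorem IsPtn.preimage_one_subset {f : α → ℕ} (hf : IsPtn ω f) (hp : ∀ a, p a ↔ AboveStrict ω a) :
    f ⁻¹' {1} ⊆ {a | ¬ p a} := fun a ha hpa =>
  (hf.one_lt ((hp a).1 hpa)).ne' ha

theorem ptnCount_consWeight [Finite α] (hp : ∀ a, p a ↔ AboveStrict ω a)
    (hω' : ∀ a b, ω' a < ω' b ↔ ω a.1 < ω b.1) (w : ℕ →₀ ℕ) :
    ptnCount ω (consWeight {a | ¬ p a}.ncard w) = ptnCount ω' w := by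
  unfold ptnCount
  rw [← Set.ncard_image_of_injective _ (extendOne_injective p)]
  congr 1
  ext f
  constructor
  · rintro ⟨hf, hw⟩
    have h1 : f ⁻¹' {1} = {a | ¬ p a} := by
      refine Set.eq_of_subset_of_ncard_le (hf.preimage_one_subset hp) ?_ (Set.toFinite _)
      rw [hw 1 le_rfl, consWeight_one]
    have hgt : ∀ a, p a → 1 < f a := fun a ha => hf.one_lt ((hp a).1 ha)
    have hfe : extendOne p (fun a => f a.1 - 1) = f := by
      funext a
      by_cases ha : p a
      · rw [extendOne_of_pos _ ha]
        have := hgt a ha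
        dsimp only
        omega
      · rw [extendOne_of_neg _ ha]
        exact (h1.ge ha : a ∈ f ⁻¹' {1}).symm
    refine ⟨fun a => f a.1 - 1, ⟨?_, fun m hm => ?_⟩, hfe⟩
    · refine (isPtn_extendOne_iff hp hω' _ fun a => ?_).1 (hfe.symm ▸ hf)
      have := hgt a.1 a.2
      omega
    · rw [← ncard_extendOne_preimage_succ _ hm, hfe, hw _ (by omega), consWeight_succ _ _ hm]
  · rintro ⟨g, ⟨hg, hw⟩, rfl⟩
    refine ⟨(isPtn_extendOne_iff hp hω' g hg.1).2 hg, fun m hm => ?_⟩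
    rcases hm.eq_or_lt with rfl | hm
    · rw [extendOne_preimage_one hg.1, consWeight_one]
    · obtain ⟨n, rfl⟩ := Nat.exists_eq_add_of_lt hm
      rw [ncard_extendOne_preimage_succ g (by omega), consWeight_succ _ _ (by omega),
        hw _ (by omega)]

theorem le_ncard_of_ptnCount_ne_zero [Finite α] (hp : ∀ a, p a ↔ AboveStrict ω a) {w : ℕ →₀ ℕ}
    (h : ptnCount ω w ≠ 0) : w 1 ≤ {a | ¬ p a}.ncard := by
  obtain ⟨f, hf, hw⟩ := (ptnCount_ne_zero_iff ω w).1 h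
  rw [← hw 1 le_rfl]
  exact Set.ncard_le_ncard (hf.preimage_one_subset hp) (Set.toFinite _)

theorem KEq.ncard_le {β : Type*} [PartialOrder β] [Finite α] [Finite β] {τ : β → ℕ}
    {q : β → Prop} (h : KEq ω τ) (hp : ∀ a, p a ↔ AboveStrict ω a)
    (hq : ∀ b, q b ↔ AboveStrict τ b) (hω' : ∀ a b, ω' a < ω' b ↔ ω a.1 < ω b.1) :
    {a | ¬ p a}.ncard ≤ {b | ¬ q b}.ncard := by
  obtain ⟨w, hw⟩ := exists_ptnCount_ne_zero ω'
  rw [← ptnCount_consWeight hp hω' w, h] at hw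
  simpa only [consWeight_one] using le_ncard_of_ptnCount_ne_zero hq hw

end Removal

/-- If `(P,ω) ~ (Q,τ)`, then the labeled posets `(P̂,ω̂)` and `(Q̂,τ̂)` obtained by removing
all jump-0 elements (with the induced orders, relabeled by the unique bijections onto
`{1,…,|P̂|}` and `{1,…,|Q̂|}` ordered consistently with `ω` and `τ`) satisfy
`(P̂,ω̂) ~ (Q̂,τ̂)`. -/
theorem stmt12 {α β : Type*} [PartialOrder α] [Fintype α] [PartialOrder β] [Fintype β]
    (ω : α → ℕ) (τ : β → ℕ) (hω : IsLabeling ω) (hτ : IsLabeling τ)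
    (h : KEq ω τ)
    (ω' : {a : α // jump ω a ≠ 0} → ℕ) (τ' : {b : β // jump τ b ≠ 0} → ℕ)
    (hω' : IsLabeling ω') (hτ' : IsLabeling τ')
    (hω'comp : ∀ a b : {a : α // jump ω a ≠ 0}, ω' a < ω' b ↔ ω a.1 < ω b.1)
    (hτ'comp : ∀ a b : {b : β // jump τ b ≠ 0}, τ' a < τ' b ↔ τ a.1 < τ b.1) :
    KEq ω' τ' := by
  have hp := jump_ne_zero_iff ω
  have hq := jump_ne_zero_iff τ
  have hcard := le_antisymm (h.ncard_le hp hq hω'comp)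
    (KEq.ncard_le (fun w => (h w).symm) hq hp hτ'comp)
  intro w
  rw [← ptnCount_consWeight hp hω'comp, ← ptnCount_consWeight hq hτ'comp, hcard]
  exact h _
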